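/- Let e be an odd integer, and let t, d ∈ ℚ₂ be nonzero with v(t) ≥ 1; write n_t = v(t) and n_d = v(d). Suppose x, l₁ ∈ 2^{(e+1)/2}ℤ₂ and y, l₂ ∈ 2^{(e−1)/2}ℤ₂ satisfy d⁻¹y − x = t·l₁ and −d·x − y = t·l₂. If n_d − n_t ≥ −1, or n_d + n_t ≤ −1, or (n_d − n_t ≤ −3 and n_d + n_t ≥ 1), then x·y·t⁻¹ ∈ 2^e ℤ₂. -/

import Mathlib

/-- `x ∈ 2^e ℤ₂` inside `ℚ₂`. -/
def inTwoPowLattice (e : ℤ) (x : ℚ_[2]) : Prop :=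
  ∃ z : ℤ_[2], x = (2 : ℚ_[2]) ^ e * (z : ℚ_[2])

/- `Padic.valuation` is the additive 2-adic valuation `v` on `ℚ₂` with `v(2) = 1`. -/

theorem inTwoPowLattice.add {e : ℤ} {x y : ℚ_[2]} (hx : inTwoPowLattice e x)
    (hy : inTwoPowLattice e y) : inTwoPowLattice e (x + y) := by
  obtain ⟨a, rfl⟩ := hx
  obtain ⟨b, rfl⟩ := hy
  exact ⟨a + b, by push_cast; ring⟩

theorem inTwoPowLattice.neg {e : ℤ} {x : ℚ_[2]} (hx : inTwoPowLattice e x) :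
    inTwoPowLattice e (-x) := by
  obtain ⟨a, rfl⟩ := hx
  exact ⟨-a, by push_cast; ring⟩

theorem inTwoPowLattice.mul {m n : ℤ} {x y : ℚ_[2]} (hx : inTwoPowLattice m x)
    (hy : inTwoPowLattice n y) : inTwoPowLattice (m + n) (x * y) := by
  obtain ⟨a, rfl⟩ := hx
  obtain ⟨b, rfl⟩ := hy
  exact ⟨a * b, by rw [zpow_add₀ two_ne_zero]; push_cast; ring⟩

theorem inTwoPowLattice.mono {m n : ℤ} {x : ℚ_[2]} (hx : inTwoPowLattice n x) (hmn : m ≤ n) :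
    inTwoPowLattice m x := by
  obtain ⟨a, rfl⟩ := hx
  obtain ⟨k, rfl⟩ := Int.le.dest hmn
  have h2 : ((2 : ℤ_[2]) : ℚ_[2]) = 2 := rfl
  exact ⟨2 ^ k * a, by rw [zpow_add₀ two_ne_zero, zpow_natCast]; push_cast; rw [h2]; ring⟩

theorem inTwoPowLattice_valuation {x : ℚ_[2]} (hx : x ≠ 0) :
    inTwoPowLattice x.valuation x := by
  have h2 : ‖(2 : ℚ_[2])‖ = 2⁻¹ := by simpa using Padic.norm_p (p := 2)
  have hnorm : ‖(2 : ℚ_[2]) ^ (-x.valuation) * x‖ ≤ 1 := by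
    rw [norm_mul, norm_zpow, h2, Padic.norm_eq_zpow_neg_valuation hx, inv_zpow', neg_neg]
    push_cast
    rw [← zpow_add₀ two_ne_zero, add_neg_cancel, zpow_zero]
  refine ⟨⟨_, hnorm⟩, ?_⟩
  change x = 2 ^ x.valuation * (2 ^ (-x.valuation) * x)
  rw [← mul_assoc, ← zpow_add₀ two_ne_zero, add_neg_cancel, zpow_zero, one_mul]

theorem inTwoPowLattice_neg_valuation_inv {x : ℚ_[2]} (hx : x ≠ 0) :
    inTwoPowLattice (-x.valuation) x⁻¹ := by
  simpa using inTwoPowLattice_valuation (inv_ne_zero hx)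

theorem inTwoPowLattice_neg_two_inv_four : inTwoPowLattice (-2) (4⁻¹ : ℚ_[2]) :=
  ⟨1, by norm_num⟩

theorem stmt_18 (e : ℤ) (he : Odd e) (t d : ℚ_[2]) (ht : t ≠ 0) (hd : d ≠ 0)
    (hvt : 1 ≤ t.valuation) (x y l₁ l₂ : ℚ_[2])
    (hx : inTwoPowLattice ((e + 1) / 2) x) (hy : inTwoPowLattice ((e - 1) / 2) y)
    (hl₁ : inTwoPowLattice ((e + 1) / 2) l₁) (hl₂ : inTwoPowLattice ((e - 1) / 2) l₂)
    (h₁ : d⁻¹ * y - x = t * l₁) (h₂ : -d * x - y = t * l₂)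
    (hcase :
      d.valuation - t.valuation ≥ -1 ∨
      d.valuation + t.valuation ≤ -1 ∨
      (d.valuation - t.valuation ≤ -3 ∧ d.valuation + t.valuation ≥ 1)) :
    inTwoPowLattice e (x * y * t⁻¹) := by
  obtain ⟨k, rfl⟩ := he
  rw [show (2 * k + 1 + 1) / 2 = k + 1 by lia] at hx hl₁
  rw [show (2 * k + 1 - 1) / 2 = k by lia] at hy hl₂
  have htv := inTwoPowLattice_valuation ht
  have hdv := inTwoPowLattice_valuation hd
  have htv' := inTwoPowLattice_neg_valuation_inv ht
  have hdv' := inTwoPowLattice_neg_valuation_inv hd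
  have hy_eq : y = d * (x + t * l₁) := by
    rw [← h₁]
    field_simp
    ring
  rcases hcase with h | h | ⟨h, h'⟩
  · have hsum : inTwoPowLattice (k + 1) (x + t * l₁) :=
      hx.add ((htv.mul hl₁).mono (by lia))
    rw [hy_eq]
    exact ((hx.mul (hdv.mul hsum)).mul htv').mono (by lia)
  · have hsum : inTwoPowLattice k (y + t * l₂) :=
      hy.add ((htv.mul hl₂).mono (by lia))
    have hx_eq : x = -(d⁻¹ * (y + t * l₂)) := by
      rw [← h₂]
      field_simp
      ring
    rw [hx_eq]
    exact (((hdv'.mul hsum).neg.mul hy).mul htv').mono (by lia)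
  · have hx_eq : x = -(t * (l₂ + d * l₁)) / (2 * d) := by
      rw [eq_div_iff (by simpa using hd)]
      linear_combination -h₂ - hy_eq
    have hprod : x * y * t⁻¹ =
        4⁻¹ * (t * d⁻¹) * (l₂ * l₂) + -(4⁻¹ * (t * d) * (l₁ * l₁)) := by
      rw [hy_eq, hx_eq]
      field_simp
      ring
    rw [hprod]
    have h4 := inTwoPowLattice_neg_two_inv_four
    exact (((h4.mul (htv.mul hdv')).mul (hl₂.mul hl₂)).mono (by lia)).add
      (((h4.mul (htv.mul hdv)).mul (hl₁.mul hl₁)).mono (by lia)).neg
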